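/- arXiv:2410.20925 — 6 statements merged into one kernel-verified Lean document; each statement's English description precedes it below -/
import Mathlib

section
/- Let r ≥ 1 and positive integers m_1,…,m_r be fixed, n = m_1+⋯+m_r, with the canonical block structure constants c and unit vector e. Let Ω ⊆ ℝⁿ be open and let Γ^i_{jk} : Ω → ℝ (i,j,k ∈ {1,…,n}) be smooth functions symmetric in the lower indices (Γ^i_{jk} = Γ^i_{kj}) and satisfying Σ_k Γ^i_{jk} e^k = 0 on Ω. Let X, Y : Ω → ℝⁿ be smooth maps such that for all i,j,k ∈ {1,…,n} and every point of Ω one has Σ_s c^i_{js}(∂_k X^s + Σ_t Γ^s_{kt} X^t) = Σ_s c^i_{ks}(∂_j X^s + Σ_t Γ^s_{jt} X^t), and the same identity with X replaced by Y. Suppose u : U → Ω, with U ⊆ ℝ² open with coordinates (x,t), is differentiable, satisfies the hodograph system x·e^i + t·X^i(u(x,t)) = Y^i(u(x,t)) for all i ∈ {1,…,n} and all (x,t) ∈ U, and suppose that the n×n matrix M(x,t) with entries M^i_j = t·∂_j X^i(u(x,t)) − ∂_j Y^i(u(x,t)) is invertible at every point of U. Then u solves the hydrodynamic-type system ∂_t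 u^i = Σ_{j,k} c^i_{jk} X^j(u) ∂_x u^k on U. -/
/-- Double index: block `α ∈ {1,…,r}` and (0-based) position inside the block. -/
abbrev BIdx {r : ℕ} (m : Fin r → ℕ) : Type := (α : Fin r) × Fin (m α)

/-- Canonical block structure constants: `c^{i(α)}_{j(β)k(γ)} = δ^α_β δ^α_γ δ^i_{j+k−1}`
(in 0-based positions: equal to `1` iff all three indices lie in the same block and
`i = j + k`). -/
noncomputable def cBlock {r : ℕ} (m : Fin r → ℕ) (i j k : BIdx m) : ℝ :=
  if i.1 = j.1 ∧ i.1 = k.1 ∧ (i.2 : ℕ) = (j.2 : ℕ) + (k.2 : ℕ) then 1 else 0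

/-- Unit vector: `e^{i(α)} = δ^i_1`. -/
noncomputable def eBlock {r : ℕ} (m : Fin r → ℕ) (i : BIdx m) : ℝ :=
  if (i.2 : ℕ) = 0 then 1 else 0

/-- Partial derivative of a scalar function on `ℝⁿ` in the `j`-th coordinate direction. -/
noncomputable def pd {ι : Type*} [Fintype ι] [DecidableEq ι]
    (f : (ι → ℝ) → ℝ) (j : ι) (p : ι → ℝ) : ℝ :=
  fderiv ℝ f p (Pi.single j 1)

/-- The product on `ℝⁿ` with structure constants `cBlock m`. -/
noncomputable def blockMul {r : ℕ} (m : Fin r → ℕ) (a b : BIdx m → ℝ) (i : BIdx m) : ℝ :=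
  ∑ j, ∑ k, cBlock m i j k * a j * b k

lemma cBlock_comm {r : ℕ} (m : Fin r → ℕ) (i j k : BIdx m) :
    cBlock m i j k = cBlock m i k j := by
  unfold cBlock
  congr 1
  rw [add_comm (j.2 : ℕ)]
  exact propext and_left_comm

lemma blockMul_comm {r : ℕ} (m : Fin r → ℕ) (a b : BIdx m → ℝ) :
    blockMul m a b = blockMul m b a := by
  funext i
  unfold blockMul
  rw [Finset.sum_comm]
  refine Finset.sum_congr rfl fun j _ => Finset.sum_congr rfl fun k _ => ?_
  rw [cBlock_comm m i k j]
  ring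

lemma sum_cBlock_mul_eBlock {r : ℕ} (m : Fin r → ℕ) (hm : ∀ α, 0 < m α) (i j : BIdx m) :
    ∑ k, cBlock m i j k * eBlock m k = if i = j then 1 else 0 := by
  rw [Finset.sum_eq_single (⟨j.1, ⟨0, hm j.1⟩⟩ : BIdx m)]
  · obtain ⟨α, i⟩ := i
    obtain ⟨β, j⟩ := j
    by_cases h : α = β
    · subst h
      simp [cBlock, eBlock, Fin.ext_iff]
    · simp [cBlock, h]
  · rintro ⟨γ, k⟩ - hk
    by_cases h : γ = j.1
    · subst h
      have : (k : ℕ) ≠ 0 := fun h0 => hk (by congr 1; exact Fin.ext h0)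
      simp [eBlock, this]
    · have : ¬ (i.1 = j.1 ∧ i.1 = γ ∧ (i.2 : ℕ) = (j.2 : ℕ) + (k : ℕ)) :=
        fun hh => h (hh.2.1.symm.trans hh.1)
      simp [cBlock, this]
  · simp

lemma blockMul_eBlock {r : ℕ} (m : Fin r → ℕ) (hm : ∀ α, 0 < m α) (a : BIdx m → ℝ) :
    blockMul m a (eBlock m) = a := by
  funext i
  have h : ∀ j, ∑ k, cBlock m i j k * a j * eBlock m k = (if i = j then 1 else 0) * a j := by
    intro j
    rw [← sum_cBlock_mul_eBlock m hm, Finset.sum_mul]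
    exact Finset.sum_congr rfl fun k _ => by ring
  simp [blockMul, h]

lemma sum_cBlock_mul_cBlock {r : ℕ} (m : Fin r → ℕ) (i j k l : BIdx m) :
    ∑ s, cBlock m i j s * cBlock m s k l =
      if i.1 = j.1 ∧ i.1 = k.1 ∧ i.1 = l.1 ∧ (i.2 : ℕ) = (j.2 : ℕ) + (k.2 : ℕ) + (l.2 : ℕ)
      then 1 else 0 := by
  obtain ⟨α, i⟩ := i
  split_ifs with h
  · obtain ⟨h1, h2, h3, h4⟩ := h
    dsimp only at h1 h2 h3 h4
    have hlt : (k.2 : ℕ) + (l.2 : ℕ) < m α := by have := i.2; omega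
    rw [Finset.sum_eq_single (⟨α, ⟨(k.2 : ℕ) + (l.2 : ℕ), hlt⟩⟩ : BIdx m)]
    · simp [cBlock, ← h1, ← h2, ← h3, h4, add_assoc]
    · rintro ⟨γ, s⟩ - hs
      by_cases hγ : γ = α
      · subst hγ
        have : (s : ℕ) ≠ (k.2 : ℕ) + (l.2 : ℕ) := fun h0 => hs (by congr 1; exact Fin.ext h0)
        simp [cBlock, this]
      · simp [cBlock, Ne.symm hγ]
    · simp
  · refine Finset.sum_eq_zero fun s _ => ?_
    unfold cBlock
    split_ifs with hj hk <;> try simp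
    obtain ⟨h1, h2, h3⟩ := hj
    obtain ⟨h4, h5, h6⟩ := hk
    exact h ⟨h1, h2.trans h4, h2.trans h5, by omega⟩

lemma blockMul_left_comm {r : ℕ} (m : Fin r → ℕ) (a b c : BIdx m → ℝ) :
    blockMul m a (blockMul m b c) = blockMul m b (blockMul m a c) := by
  have expand : ∀ a b c : BIdx m → ℝ, ∀ i, blockMul m a (blockMul m b c) i =
      ∑ j, ∑ k, ∑ l, (∑ s, cBlock m i j s * cBlock m s k l) * (a j * b k * c l) := by
    intro a b c i
    unfold blockMul
    refine Finset.sum_congr rfl fun j _ => ?_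
    simp_rw [Finset.mul_sum, Finset.sum_mul]
    rw [Finset.sum_comm]
    refine Finset.sum_congr rfl fun k _ => ?_
    rw [Finset.sum_comm]
    refine Finset.sum_congr rfl fun l _ => Finset.sum_congr rfl fun s _ => ?_
    ring
  funext i
  rw [expand, expand, Finset.sum_comm]
  refine Finset.sum_congr rfl fun j _ => Finset.sum_congr rfl fun k _ =>
    Finset.sum_congr rfl fun l _ => ?_
  rw [sum_cBlock_mul_cBlock, sum_cBlock_mul_cBlock, add_comm (k.2 : ℕ), mul_comm (a k)]
  congr 2
  exact propext and_left_comm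

/-- An endomorphism `M` with `c^i_{js} M^s_k` symmetric in `j, k` is multiplication by `M e`. -/
lemma mulVec_eq_blockMul {r : ℕ} (m : Fin r → ℕ) (hm : ∀ α, 0 < m α)
    (M : Matrix (BIdx m) (BIdx m) ℝ)
    (hM : ∀ i j k, ∑ s, cBlock m i j s * M s k = ∑ s, cBlock m i k s * M s j)
    (v : BIdx m → ℝ) :
    M.mulVec v = blockMul m v (M.mulVec (eBlock m)) := by
  have key : ∀ i k, M i k = ∑ s, cBlock m i k s * M.mulVec (eBlock m) s := by
    intro i k
    calc M i k = ∑ s, (∑ j, cBlock m i s j * eBlock m j) * M s k := by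
          simp [sum_cBlock_mul_eBlock m hm]
      _ = ∑ j, eBlock m j * ∑ s, cBlock m i j s * M s k := by
          simp_rw [Finset.sum_mul, Finset.mul_sum]
          rw [Finset.sum_comm]
          refine Finset.sum_congr rfl fun j _ => Finset.sum_congr rfl fun s _ => ?_
          rw [cBlock_comm]
          ring
      _ = ∑ j, eBlock m j * ∑ s, cBlock m i k s * M s j := by simp_rw [hM i _ k]
      _ = ∑ s, cBlock m i k s * M.mulVec (eBlock m) s := by
          simp_rw [Matrix.mulVec, dotProduct, Finset.mul_sum]
          rw [Finset.sum_comm]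
          exact Finset.sum_congr rfl fun j _ => Finset.sum_congr rfl fun s _ => by ring
  funext i
  rw [Matrix.mulVec, dotProduct]
  unfold blockMul
  refine Finset.sum_congr rfl fun j _ => ?_
  rw [key, Finset.sum_mul]
  exact Finset.sum_congr rfl fun k _ => by ring

lemma fderiv_eq_sum_pd {ι : Type*} [Fintype ι] [DecidableEq ι]
    (f : (ι → ℝ) → ℝ) (p v : ι → ℝ) :
    fderiv ℝ f p v = ∑ j, pd f j p * v j := by
  conv_lhs => rw [pi_eq_sum_univ' v]
  simp [pd, map_sum, mul_comm]

/-- the generalised hodograph method for regular non-diagonalisable systems of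
hydrodynamic type.  If `u(x,t)` solves the hodograph system `x·e + t·X(u) = Y(u)` where
`d_∇(X∘) = 0 = d_∇(Y∘)` for a torsionless connection with `∇e = 0`, and the matrix
`M^i_j = t·∂_j X^i − ∂_j Y^i` is invertible along `u`, then `u` solves
`∂_t u^i = Σ_{j,k} c^i_{jk} X^j(u) ∂_x u^k`. -/
theorem generalised_hodograph_method
    (r : ℕ) (hr : 1 ≤ r) (m : Fin r → ℕ) (hm : ∀ α, 0 < m α)
    (Ω : Set (BIdx m → ℝ)) (hΩ : IsOpen Ω)
    (Γ : BIdx m → BIdx m → BIdx m → (BIdx m → ℝ) → ℝ)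
    (hΓsmooth : ∀ i j k, ContDiffOn ℝ (⊤ : ℕ∞) (Γ i j k) Ω)
    (hΓsym : ∀ i j k, ∀ p ∈ Ω, Γ i j k p = Γ i k j p)
    (hΓe : ∀ i j, ∀ p ∈ Ω, ∑ k, Γ i j k p * eBlock m k = 0)
    (X Y : (BIdx m → ℝ) → (BIdx m → ℝ))
    (hXsmooth : ContDiffOn ℝ (⊤ : ℕ∞) X Ω) (hYsmooth : ContDiffOn ℝ (⊤ : ℕ∞) Y Ω)
    (hdX : ∀ i j k, ∀ p ∈ Ω,
      ∑ s, cBlock m i j s * (pd (fun u => X u s) k p + ∑ t', Γ s k t' p * X p t')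
        = ∑ s, cBlock m i k s * (pd (fun u => X u s) j p + ∑ t', Γ s j t' p * X p t'))
    (hdY : ∀ i j k, ∀ p ∈ Ω,
      ∑ s, cBlock m i j s * (pd (fun u => Y u s) k p + ∑ t', Γ s k t' p * Y p t')
        = ∑ s, cBlock m i k s * (pd (fun u => Y u s) j p + ∑ t', Γ s j t' p * Y p t'))
    (U : Set (ℝ × ℝ)) (hU : IsOpen U)
    (u : ℝ × ℝ → (BIdx m → ℝ))
    (hu : ∀ q ∈ U, DifferentiableAt ℝ u q)
    (humaps : ∀ q ∈ U, u q ∈ Ω)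
    (hhodo : ∀ q ∈ U, ∀ i, q.1 * eBlock m i + q.2 * X (u q) i = Y (u q) i)
    (hMinv : ∀ q ∈ U, IsUnit (Matrix.det (Matrix.of fun i j : BIdx m =>
      q.2 * pd (fun v => X v i) j (u q) - pd (fun v => Y v i) j (u q)))) :
    ∀ q ∈ U, ∀ i : BIdx m,
      fderiv ℝ (fun q' => u q' i) q ((0 : ℝ), (1 : ℝ))
        = ∑ j, ∑ k, cBlock m i j k * X (u q) j
            * fderiv ℝ (fun q' => u q' k) q ((1 : ℝ), (0 : ℝ)) := by
  intro q hq
  have hp := humaps q hq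
  have hX : ∀ i, DifferentiableAt ℝ (fun v => X v i) (u q) := differentiableAt_pi.1
    ((hXsmooth.contDiffAt (hΩ.mem_nhds hp)).differentiableAt (by simp))
  have hY : ∀ i, DifferentiableAt ℝ (fun v => Y v i) (u q) := differentiableAt_pi.1
    ((hYsmooth.contDiffAt (hΩ.mem_nhds hp)).differentiableAt (by simp))
  have hcomp : ∀ (d : ℝ × ℝ) i, fderiv ℝ (fun q' => u q' i) q d = fderiv ℝ u q d i := by
    intro d i
    rw [(hasFDerivAt_pi'.1 (hu q hq).hasFDerivAt i).fderiv]
    rfl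
  set M : Matrix (BIdx m) (BIdx m) ℝ := Matrix.of fun i j =>
    q.2 * pd (fun v => X v i) j (u q) - pd (fun v => Y v i) j (u q) with hMdef
  have hMcov : ∀ s k, M s k =
      q.2 * (pd (fun v => X v s) k (u q) + ∑ t', Γ s k t' (u q) * X (u q) t')
        - (pd (fun v => Y v s) k (u q) + ∑ t', Γ s k t' (u q) * Y (u q) t') := by
    intro s k
    have h : ∑ t', Γ s k t' (u q) * Y (u q) t' =
        q.1 * ∑ t', Γ s k t' (u q) * eBlock m t' + q.2 * ∑ t', Γ s k t' (u q) * X (u q) t' := by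
      rw [Finset.mul_sum, Finset.mul_sum, ← Finset.sum_add_distrib]
      refine Finset.sum_congr rfl fun t' _ => ?_
      rw [← hhodo q hq t']
      ring
    rw [h, hΓe s k _ hp, hMdef, Matrix.of_apply]
    ring
  have hMsym : ∀ i j k, ∑ s, cBlock m i j s * M s k = ∑ s, cBlock m i k s * M s j := by
    intro i j k
    simp_rw [hMcov, mul_sub, mul_left_comm (cBlock m _ _ _) q.2]
    rw [Finset.sum_sub_distrib, Finset.sum_sub_distrib, ← Finset.mul_sum, ← Finset.mul_sum,
      hdX i j k _ hp, hdY i j k _ hp]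
  have hderiv : ∀ (d : ℝ × ℝ) i,
      d.1 * eBlock m i + d.2 * X (u q) i + M.mulVec (fderiv ℝ u q d) i = 0 := by
    intro d i
    have hu' := (hu q hq).hasFDerivAt
    have hF := ((hasFDerivAt_fst (𝕜 := ℝ) (p := q)).mul_const (eBlock m i)).add
      ((hasFDerivAt_snd (𝕜 := ℝ) (p := q)).mul ((hX i).hasFDerivAt.comp q hu'))
    have hG := (hY i).hasFDerivAt.comp q hu'
    have hFG := hG.congr_of_eventuallyEq
      (Filter.eventuallyEq_of_mem (hU.mem_nhds hq) fun q' hq' => hhodo q' hq' i)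
    have h := congrArg (fun L : ℝ × ℝ →L[ℝ] ℝ => L d) (hF.unique hFG)
    simp only [add_apply, smul_apply,
      ContinuousLinearMap.comp_apply, Function.comp_apply, smul_eq_mul,
      ContinuousLinearMap.coe_fst', ContinuousLinearMap.coe_snd', fderiv_eq_sum_pd] at h
    have hMv : M.mulVec (fderiv ℝ u q d) i =
        q.2 * ∑ j, pd (fun v => X v i) j (u q) * fderiv ℝ u q d j
          - ∑ j, pd (fun v => Y v i) j (u q) * fderiv ℝ u q d j := by
      rw [Matrix.mulVec, dotProduct, Finset.mul_sum, ← Finset.sum_sub_distrib]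
      refine Finset.sum_congr rfl fun j _ => ?_
      rw [hMdef, Matrix.of_apply]
      ring
    rw [hMv]
    linarith
  have hx : M.mulVec (fderiv ℝ u q (1, 0)) = -eBlock m := by
    funext i
    have := hderiv (1, 0) i
    simp only [Pi.neg_apply]
    linarith
  have ht : M.mulVec (fderiv ℝ u q (0, 1)) = -X (u q) := by
    funext i
    have := hderiv (0, 1) i
    simp only [Pi.neg_apply]
    linarith
  have hneg : blockMul m (X (u q)) (-eBlock m) = -X (u q) := by
    conv_rhs => rw [← blockMul_eBlock m hm (X (u q))]
    funext i
    simp [blockMul]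
  have hprod : M.mulVec (blockMul m (X (u q)) (fderiv ℝ u q (1, 0))) = -X (u q) := by
    rw [mulVec_eq_blockMul m hm M hMsym, blockMul_comm, blockMul_left_comm,
      blockMul_comm m (M.mulVec _), ← mulVec_eq_blockMul m hm M hMsym, hx, hneg]
  have hsol := Matrix.mulVec_injective_of_isUnit
    ((Matrix.isUnit_iff_isUnit_det M).2 (hMinv q hq)) (ht.trans hprod.symm)
  intro i
  simp_rw [hcomp]
  exact congrFun hsol i
end

section
/- Let r ≥ 1 and positive integers m_1,…,m_r be fixed, n = m_1+⋯+m_r, with the canonical block structure constants c. If an n×n real matrix M satisfies Σ_s c^i_{js} M^s_k = Σ_s c^i_{ks} M^s_j for all i,j,k ∈ {1,…,n}, then M is block-diagonal lower-triangular Toeplitz; explicitly, M^{i(α)}_{j(β)} = 0 whenever α ≠ β, M^{i(α)}_{j(α)} = 0 whenever i < j, and M^{i(α)}_{j(α)} = M^{(i−j+1)(α)}_{1(α)} whenever i ≥ j. -/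
theorem sum_cBlock_mul_of_le {r : ℕ} {m : Fin r → ℕ} (f : BIdx m → ℝ) (α : Fin r)
    (i j : Fin (m α)) (h : (j : ℕ) ≤ (i : ℕ)) :
    ∑ s, cBlock m ⟨α, i⟩ ⟨α, j⟩ s * f s
      = f ⟨α, ⟨(i : ℕ) - (j : ℕ), lt_of_le_of_lt (Nat.sub_le _ _) i.isLt⟩⟩ := by
  rw [Finset.sum_eq_single ⟨α, ⟨(i : ℕ) - (j : ℕ), lt_of_le_of_lt (Nat.sub_le _ _) i.isLt⟩⟩]
  · have hij : (i : ℕ) = j + (i - j) := by omega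
    simp [cBlock, ← hij]
  · rintro ⟨β, k⟩ - hk
    rw [cBlock, if_neg, zero_mul]
    rintro ⟨-, hβ, hik⟩
    dsimp only at hβ hik
    subst hβ
    apply hk
    congr 1
    ext
    dsimp only
    omega
  · simp

theorem sum_cBlock_mul_of_ne {r : ℕ} {m : Fin r → ℕ} (f : BIdx m → ℝ) {i j : BIdx m}
    (h : i.1 ≠ j.1) : ∑ s, cBlock m i j s * f s = 0 := by
  simp [cBlock, h]

theorem sum_cBlock_mul_of_lt {r : ℕ} {m : Fin r → ℕ} (f : BIdx m → ℝ) {i j : BIdx m}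
    (h : (i.2 : ℕ) < (j.2 : ℕ)) : ∑ s, cBlock m i j s * f s = 0 := by
  refine Finset.sum_eq_zero fun s _ => ?_
  rw [cBlock, if_neg (by omega), zero_mul]

/-- a matrix `M` satisfying `Σ_s c^i_{js} M^s_k = Σ_s c^i_{ks} M^s_j` is
block-diagonal lower-triangular Toeplitz. -/
theorem matrix_commuting_with_product_is_block_toeplitz
    (r : ℕ) (hr : 1 ≤ r) (m : Fin r → ℕ) (hm : ∀ α, 0 < m α)
    (M : Matrix (BIdx m) (BIdx m) ℝ)
    (hM : ∀ i j k : BIdx m,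
      ∑ s, cBlock m i j s * M s k = ∑ s, cBlock m i k s * M s j) :
    (∀ (α β : Fin r) (i : Fin (m α)) (j : Fin (m β)), α ≠ β → M ⟨α, i⟩ ⟨β, j⟩ = 0) ∧
    (∀ (α : Fin r) (i j : Fin (m α)), (i : ℕ) < (j : ℕ) → M ⟨α, i⟩ ⟨α, j⟩ = 0) ∧
    (∀ (α : Fin r) (i j : Fin (m α)), (j : ℕ) ≤ (i : ℕ) →
      M ⟨α, i⟩ ⟨α, j⟩
        = M ⟨α, ⟨(i : ℕ) - (j : ℕ), lt_of_le_of_lt (Nat.sub_le _ _) i.isLt⟩⟩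
            ⟨α, ⟨0, Nat.lt_of_le_of_lt (Nat.zero_le _) i.isLt⟩⟩) := by
  have key (α : Fin r) (i : Fin (m α)) (k : BIdx m) :
      M ⟨α, i⟩ k = ∑ s, cBlock m ⟨α, i⟩ k s * M s ⟨α, ⟨0, hm α⟩⟩ := by
    rw [← hM ⟨α, i⟩ ⟨α, ⟨0, hm α⟩⟩ k,
      sum_cBlock_mul_of_le (fun s => M s k) α i ⟨0, hm α⟩ (Nat.zero_le _)]
    rfl
  refine ⟨fun α β i j h => ?_, fun α i j h => ?_, fun α i j h => ?_⟩
  · rw [key]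
    exact sum_cBlock_mul_of_ne _ h
  · rw [key]
    exact sum_cBlock_mul_of_lt _ h
  · rw [key]
    exact sum_cBlock_mul_of_le (fun s => M s ⟨α, ⟨0, hm α⟩⟩) α i j h
end

section
/- Let n ≥ 1, let c^i_{jk} ∈ ℝ (i,j,k ∈ {1,…,n}) be commutative (c^i_{jk} = c^i_{kj}) and associative (Σ_s c^i_{js} c^s_{kt} = Σ_s c^i_{ks} c^s_{jt}) structure constants, and let e ∈ ℝⁿ satisfy Σ_j c^i_{jk} e^j = δ^i_k for all i,k (e is the unit). Let R^i_{jkl} ∈ ℝ (i,j,k,l ∈ {1,…,n}) be any array antisymmetric in its last two lower indices: R^i_{jkl} = −R^i_{jlk}. If for all i,t,j,k ∈ {1,…,n} one has R^i_{tjk} + Σ_{s,m} c^i_{ks} R^s_{tmj} e^m + Σ_{s,m} c^i_{js} R^s_{tkm} e^m = 0, then for all i,t,j,k,m ∈ {1,…,n}: Σ_s ( c^i_{sm} R^s_{tjk} + c^i_{ks} R^s_{tmj} + c^i_{js} R^s_{tkm} ) = 0. -/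
/-- Multiplication operators of an associative product with commuting structure constants
commute. -/
theorem sum_structureConstants_mul_left_comm {ι A : Type*} [Fintype ι] [CommSemiring A]
    {c : ι → ι → ι → A}
    (hassoc : ∀ i j k t, ∑ s, c i j s * c s k t = ∑ s, c i k s * c s j t)
    (v : ι → A) (i j k : ι) :
    ∑ s, c i j s * ∑ u, c s k u * v u = ∑ s, c i k s * ∑ u, c s j u * v u := by
  simp only [Finset.mul_sum, ← mul_assoc]
  rw [Finset.sum_comm, Finset.sum_comm (f := fun s u => c i k s * c s j u * v u)]
  simp only [← Finset.sum_mul, hassoc i j k]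

/-- For a commutative associative product with unit `e`, and any array `R`
antisymmetric in its last two lower indices, the contracted curvature condition implies the
full curvature condition. -/
theorem contracted_curvature_condition_implies_full
    (n : ℕ) (hn : 1 ≤ n) (c : Fin n → Fin n → Fin n → ℝ)
    (hcomm : ∀ i j k, c i j k = c i k j)
    (hassoc : ∀ i j k t, ∑ s, c i j s * c s k t = ∑ s, c i k s * c s j t)
    (e : Fin n → ℝ)
    (hunit : ∀ i k, ∑ j, c i j k * e j = if i = k then (1 : ℝ) else 0)
    (R : Fin n → Fin n → Fin n → Fin n → ℝ)
    (hanti : ∀ i j k l, R i j k l = - R i j l k)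
    (hred : ∀ i t j k,
      R i t j k + (∑ s, ∑ m, c i k s * R s t m j * e m)
        + (∑ s, ∑ m, c i j s * R s t k m * e m) = 0) :
    ∀ i t j k m,
      ∑ s, (c i s m * R s t j k + c i k s * R s t m j + c i j s * R s t k m) = 0 := by
  intro i t j k m
  set B : Fin n → Fin n → ℝ := fun j s => ∑ m, R s t m j * e m with hB
  have hR : ∀ i j k, R i t j k = ∑ s, c i j s * B k s - ∑ s, c i k s * B j s := by
    intro i j k
    have h := hred i t j k
    have h₁ : ∑ s, ∑ m, c i k s * R s t m j * e m = ∑ s, c i k s * B j s := by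
      simp only [hB, Finset.mul_sum, mul_assoc]
    have h₂ : ∑ s, ∑ m, c i j s * R s t k m * e m = - ∑ s, c i j s * B k s := by
      simp only [hB, Finset.mul_sum, ← Finset.sum_neg_distrib]
      refine Finset.sum_congr rfl fun s _ => Finset.sum_congr rfl fun m _ => ?_
      rw [hanti s t k m]
      ring
    linarith
  have hmul : ∀ m j k, ∑ s, c i m s * R s t j k =
      ∑ s, c i m s * ∑ u, c s j u * B k u - ∑ s, c i m s * ∑ u, c s k u * B j u := by
    intro m j k
    simp only [hR _ j k, mul_sub, Finset.sum_sub_distrib]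
  simp only [Finset.sum_add_distrib, hcomm i _ m, hmul]
  rw [sum_structureConstants_mul_left_comm hassoc (B k) i m j,
    sum_structureConstants_mul_left_comm hassoc (B j) i m k,
    sum_structureConstants_mul_left_comm hassoc (B m) i k j]
  ring
end

section
/- Let r ≥ 1 and positive integers m_1,…,m_r be fixed, n = m_1+⋯+m_r, with the canonical block structure constants c. Let Ω ⊆ ℝⁿ be open and let Γ^i_{jk} : Ω → ℝ be functions such that Γ^{i(α)}_{j(β)k(γ)} = 0 whenever α, β, γ are pairwise distinct. Adopt the convention that Y^{l(α)} := 0 and Γ^{l(α)}_{pq} := 0 whenever l ≤ 0. Then a differentiable map Y : Ω → ℝⁿ satisfies, for all α,β,γ ∈ {1,…,r} and all i ∈ {1,…,m_α}, j ∈ {1,…,m_β}, k ∈ {1,…,m_γ}, the condition δ^α_β ( ∂_{k(γ)} Y^{(i−j+1)(α)} + Σ_{σ=1}^{r} Σ_{s=1}^{m_σ} Γ^{(i−j+1)(α)}_{k(γ)s(σ)} Y^{s(σ)} ) = δ^α_γ ( ∂_{j(β)} Y^{(i−k+1)(α)} + Σ_{σ=1}^{r} Σ_{s=1}^{m_σ}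 Γ^{(i−k+1)(α)}_{j(β)s(σ)} Y^{s(σ)} ) if and only if the following two families of equations hold: (i) for all α ≠ β, i ∈ {1,…,m_α}, j ∈ {1,…,m_β}: ∂_{j(β)} Y^{i(α)} = − Σ_{s=1}^{m_α} Γ^{i(α)}_{j(β)s(α)} Y^{s(α)} − Σ_{s=1}^{m_β} Γ^{i(α)}_{j(β)s(β)} Y^{s(β)}; and (ii) for all α, i ∈ {1,…,m_α}, k ∈ {2,…,m_α}: ∂_{k(α)} Y^{i(α)} = ∂_{1(α)} Y^{(i−k+1)(α)} + Σ_{σ=1}^{r} Σ_{s=1}^{m_σ} ( Γ^{(i−k+1)(α)}_{1(α)s(σ)} − Γ^{i(α)}_{k(α)s(σ)} ) Y^{s(σ)}. -/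
/-- A sum over double indices whose terms live in two distinct blocks `α`, `β` only. -/
theorem sum_bIdx_eq_add {r : ℕ} {m : Fin r → ℕ} {α β : Fin r} (hαβ : α ≠ β) (f : BIdx m → ℝ)
    (hf : ∀ σ s, σ ≠ α → σ ≠ β → f ⟨σ, s⟩ = 0) :
    ∑ s, f s = ∑ s : Fin (m α), f ⟨α, s⟩ + ∑ s : Fin (m β), f ⟨β, s⟩ := by
  rw [Fintype.sum_sigma]
  exact Fintype.sum_eq_add α β hαβ fun σ hσ =>
    Finset.sum_eq_zero fun s _ => hf σ s hσ.1 hσ.2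

/-- A family `D α l q` vanishing for `l ≤ 0` satisfies the block symmetry condition iff it
vanishes across distinct blocks and, within a block, is determined by its values in the
first direction. -/
theorem block_symmetry_iff {r : ℕ} {m : Fin r → ℕ} (hm : ∀ α, 0 < m α)
    (D : Fin r → ℤ → BIdx m → ℝ) (hD : ∀ α l q, l ≤ 0 → D α l q = 0) :
    (∀ (α β γ : Fin r) (i : Fin (m α)) (j : Fin (m β)) (k : Fin (m γ)),
      (if α = β then (1 : ℝ) else 0) * D α ((i : ℤ) - (j : ℤ) + 1) ⟨γ, k⟩
        = (if α = γ then (1 : ℝ) else 0) * D α ((i : ℤ) - (k : ℤ) + 1) ⟨β, j⟩) ↔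
    (∀ (α β : Fin r) (i : Fin (m α)) (j : Fin (m β)), α ≠ β →
      D α ((i : ℤ) + 1) ⟨β, j⟩ = 0) ∧
    ∀ (α : Fin r) (i k : Fin (m α)), 1 ≤ (k : ℕ) →
      D α ((i : ℤ) + 1) ⟨α, k⟩ = D α ((i : ℤ) - (k : ℤ) + 1) ⟨α, ⟨0, hm α⟩⟩ := by
  constructor
  · intro h
    refine ⟨fun α β i j hαβ => ?_, fun α i k _ => ?_⟩
    · simpa [hαβ] using h α α β i ⟨0, hm α⟩ j
    · simpa using h α α α i ⟨0, hm α⟩ k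
  · rintro ⟨h₁, h₂⟩
    have off_block : ∀ (α γ : Fin r) (i j : Fin (m α)) (k : Fin (m γ)), α ≠ γ →
        D α ((i : ℤ) - (j : ℤ) + 1) ⟨γ, k⟩ = 0 := by
      intro α γ i j k hαγ
      rcases lt_or_ge (i : ℕ) j with hij | hij
      · exact hD _ _ _ (by omega)
      · have := h₁ α γ ⟨i - j, by omega⟩ k hαγ
        rwa [Nat.cast_sub hij] at this
    have in_block : ∀ (α : Fin r) (i j k : Fin (m α)),
        D α ((i : ℤ) - (j : ℤ) + 1) ⟨α, k⟩
          = D α ((i : ℤ) - (j : ℤ) - (k : ℤ) + 1) ⟨α, ⟨0, hm α⟩⟩ := by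
      intro α i j k
      rcases Nat.eq_zero_or_pos (k : ℕ) with hk | hk
      · obtain rfl : k = ⟨0, hm α⟩ := Fin.ext hk
        simp
      rcases lt_or_ge (i : ℕ) j with hij | hij
      · rw [hD _ _ _ (by omega), hD _ _ _ (by omega)]
      · have := h₂ α ⟨i - j, by omega⟩ k hk
        rwa [Nat.cast_sub hij] at this
    intro α β γ i j k
    by_cases hβ : α = β
    · subst hβ
      by_cases hγ : α = γ
      · subst hγ
        rw [in_block, in_block, sub_right_comm]
      · simp [hγ, off_block α γ i j k hγ]
    · by_cases hγ : α = γ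
      · subst hγ
        simp [hβ, off_block α β i k j hβ]
      · simp [hβ, hγ]

/-- the condition `d_∇(Y∘) = 0`, written out in block indices (with the
convention that components `Y^{l(α)}` and Christoffel symbols `Γ^{l(α)}_{pq}` with
non-positive 1-based index `l` vanish), is equivalent to the two families of equations
(i) (for distinct blocks) and (ii) (within a block, `k ≥ 2`).
Here `Yext p α l` denotes the extended component `Y^{l(α)}(p)` for a 1-based integer
index `l`, and `Γext α l q₁ q₂ p` the extended Christoffel symbol `Γ^{l(α)}_{q₁q₂}(p)`. -/
theorem dnabla_Y_eq_zero_iff_symmetry_families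
    (r : ℕ) (hr : 1 ≤ r) (m : Fin r → ℕ) (hm : ∀ α, 0 < m α)
    (Ω : Set (BIdx m → ℝ)) (hΩ : IsOpen Ω)
    (Γ : BIdx m → BIdx m → BIdx m → (BIdx m → ℝ) → ℝ)
    (hΓ0 : ∀ (α β γ : Fin r) (i : Fin (m α)) (j : Fin (m β)) (k : Fin (m γ)),
      α ≠ β → β ≠ γ → α ≠ γ → ∀ p, Γ ⟨α, i⟩ ⟨β, j⟩ ⟨γ, k⟩ p = 0)
    (Y : (BIdx m → ℝ) → (BIdx m → ℝ))
    (hY : DifferentiableOn ℝ Y Ω)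
    (Yext : (BIdx m → ℝ) → (α : Fin r) → ℤ → ℝ)
    (hYext : ∀ (p : BIdx m → ℝ) (α : Fin r) (l : ℤ),
      Yext p α l = if h : 0 < l ∧ l ≤ (m α : ℤ)
        then Y p ⟨α, ⟨(l - 1).toNat, by omega⟩⟩ else 0)
    (Γext : (α : Fin r) → ℤ → BIdx m → BIdx m → (BIdx m → ℝ) → ℝ)
    (hΓext : ∀ (α : Fin r) (l : ℤ) (q₁ q₂ : BIdx m) (p : BIdx m → ℝ),
      Γext α l q₁ q₂ p = if h : 0 < l ∧ l ≤ (m α : ℤ)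
        then Γ ⟨α, ⟨(l - 1).toNat, by omega⟩⟩ q₁ q₂ p else 0) :
    -- d_∇(Y∘) = 0 in block indices …
    (∀ p ∈ Ω, ∀ (α β γ : Fin r) (i : Fin (m α)) (j : Fin (m β)) (k : Fin (m γ)),
      (if α = β then (1 : ℝ) else 0) *
        (pd (fun v => Yext v α ((i : ℤ) - (j : ℤ) + 1)) ⟨γ, k⟩ p
          + ∑ s : BIdx m, Γext α ((i : ℤ) - (j : ℤ) + 1) ⟨γ, k⟩ s p * Y p s)
      = (if α = γ then (1 : ℝ) else 0) *
        (pd (fun v => Yext v α ((i : ℤ) - (k : ℤ) + 1)) ⟨β, j⟩ p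
          + ∑ s : BIdx m, Γext α ((i : ℤ) - (k : ℤ) + 1) ⟨β, j⟩ s p * Y p s))
    ↔
    -- … iff family (i) …
    ((∀ p ∈ Ω, ∀ (α β : Fin r) (i : Fin (m α)) (j : Fin (m β)), α ≠ β →
        pd (fun v => Y v ⟨α, i⟩) ⟨β, j⟩ p
          = -(∑ s : Fin (m α), Γ ⟨α, i⟩ ⟨β, j⟩ ⟨α, s⟩ p * Y p ⟨α, s⟩)
            - ∑ s : Fin (m β), Γ ⟨α, i⟩ ⟨β, j⟩ ⟨β, s⟩ p * Y p ⟨β, s⟩) ∧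
    -- … and family (ii).
      (∀ p ∈ Ω, ∀ (α : Fin r) (i k : Fin (m α)), 1 ≤ (k : ℕ) →
        pd (fun v => Y v ⟨α, i⟩) ⟨α, k⟩ p
          = pd (fun v => Yext v α ((i : ℤ) - (k : ℤ) + 1)) ⟨α, ⟨0, hm α⟩⟩ p
            + ∑ s : BIdx m,
                (Γext α ((i : ℤ) - (k : ℤ) + 1) ⟨α, ⟨0, hm α⟩⟩ s p
                  - Γ ⟨α, i⟩ ⟨α, k⟩ s p) * Y p s)) := by
  have Yext_succ : ∀ (v : BIdx m → ℝ) (α : Fin r) (i : Fin (m α)),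
      Yext v α ((i : ℤ) + 1) = Y v ⟨α, i⟩ := by
    intro v α i
    rw [hYext, dif_pos (by omega)]
    congr 3
    omega
  have Γext_succ : ∀ (α : Fin r) (i : Fin (m α)) (q₁ q₂ : BIdx m) (p : BIdx m → ℝ),
      Γext α ((i : ℤ) + 1) q₁ q₂ p = Γ ⟨α, i⟩ q₁ q₂ p := by
    intro α i q₁ q₂ p
    rw [hΓext, dif_pos (by omega)]
    congr 3
    omega
  rw [← forall₂_and]
  refine forall₂_congr fun p _ => ?_
  rw [block_symmetry_iff hm
    (fun α l q => pd (fun v => Yext v α l) q p + ∑ s : BIdx m, Γext α l q s p * Y p s)]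
  · simp only [Yext_succ, Γext_succ]
    refine and_congr ?_ ?_
    · refine forall₄_congr fun α β i j => forall_congr' fun hαβ => ?_
      rw [sum_bIdx_eq_add hαβ]
      · constructor <;> intro h <;> linarith
      · intro σ s hα hβ
        rw [hΓ0 α β σ i j s hαβ hβ.symm hα.symm, zero_mul]
    · refine forall₃_congr fun α i k => forall_congr' fun _ => ?_
      simp only [sub_mul, Finset.sum_sub_distrib]
      constructor <;> intro h <;> linarith
  · intro α l q hl
    simp [pd, hYext, hΓext, not_lt.2 hl]
end

section
/- Let ε₁ ∈ ℝ with ε₁ ≠ 1, and let f₁, f₂ : ℝ → ℝ be differentiable. Define on the domain {(u¹,u²) ∈ ℝ² : u² > 0}: Y¹(u¹,u²) := f₁(u¹) and Y²(u¹,u²) := u² f₁′(u¹)/(1−ε₁) + (u²)^{ε₁} f₂(u¹). Then Y¹, Y² satisfy the system ∂₂Y¹ = 0 and ∂₂Y² = ∂₁Y¹ + (ε₁/u²) Y², where ∂₁, ∂₂ denote differentiation with respect to u¹, u². -/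
/-- explicit family of symmetries for the 2-dimensional single-Jordan-block
Lauricella system (`ε₂ = 0`): `Y¹ = f₁(u¹)`, `Y² = u² f₁′(u¹)/(1−ε₁) + (u²)^{ε₁} f₂(u¹)`
satisfy `∂₂Y¹ = 0` and `∂₂Y² = ∂₁Y¹ + (ε₁/u²) Y²` on `{u² > 0}`. -/
theorem lauricella_symmetries_dim2
    (ε₁ : ℝ) (hε₁ : ε₁ ≠ 1) (f₁ f₂ : ℝ → ℝ)
    (hf₁ : Differentiable ℝ f₁) (hf₂ : Differentiable ℝ f₂)
    (Y₁ Y₂ : ℝ → ℝ → ℝ)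
    (hY₁ : ∀ u₁ u₂ : ℝ, Y₁ u₁ u₂ = f₁ u₁)
    (hY₂ : ∀ u₁ u₂ : ℝ, Y₂ u₁ u₂ = u₂ * deriv f₁ u₁ / (1 - ε₁) + u₂ ^ ε₁ * f₂ u₁) :
    ∀ u₁ u₂ : ℝ, 0 < u₂ →
      deriv (fun s => Y₁ u₁ s) u₂ = 0 ∧
      deriv (fun s => Y₂ u₁ s) u₂
        = deriv (fun s => Y₁ s u₂) u₁ + (ε₁ / u₂) * Y₂ u₁ u₂ := by
  intro u₁ u₂ hu
  have hsub : 1 - ε₁ ≠ 0 := sub_ne_zero.mpr hε₁.symm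
  simp only [hY₁, hY₂]
  refine ⟨deriv_const u₂ (f₁ u₁), ?_⟩
  have hderiv : HasDerivAt (fun s : ℝ => s * deriv f₁ u₁ / (1 - ε₁) + s ^ ε₁ * f₂ u₁)
      (1 * deriv f₁ u₁ / (1 - ε₁) + ε₁ * u₂ ^ (ε₁ - 1) * f₂ u₁) u₂ :=
    (((hasDerivAt_id' u₂).mul_const _).div_const _).add
      ((Real.hasDerivAt_rpow_const (Or.inl hu.ne')).mul_const _)
  rw [hderiv.deriv, Real.rpow_sub_one hu.ne']
  field_simp
  ring
end

section
/- Let ε₁, ε₂, λ ∈ ℝ with ε₂ ≠ 0. Let f : ℝ → ℝ be differentiable with f′(u¹) = λ f(u¹) for all u¹, and let g : (0,∞) → ℝ be twice differentiable with u² g″(u²) + (1−ε₁) g′(u²) + λ ε₂ g(u²) = 0 for all u² > 0. Define on {(u¹,u²) : u² > 0}: Y¹(u¹,u²) := f(u¹) g(u²) and Y²(u¹,u²) := −(u²/ε₂) f(u¹) g′(u²). Then ∂₂Y¹ = −(ε₂/u²) Y² and ∂₂Y² = (ε₁/u²) Y² + ∂₁Y¹, where ∂₁, ∂₂ denote differentiation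 with respect to u¹, u². -/
/-- separated-variables construction of symmetries for the 2-dimensional
single-Jordan-block system: if `f′ = λf` and `u² g″ + (1−ε₁) g′ + λε₂ g = 0` on `(0,∞)`,
then `Y¹ = f g`, `Y² = −(u²/ε₂) f g′` solve the symmetry system. -/
theorem separated_variables_symmetries_dim2
    (ε₁ ε₂ lam : ℝ) (hε₂ : ε₂ ≠ 0)
    (f : ℝ → ℝ) (hf : Differentiable ℝ f) (hf' : ∀ u : ℝ, deriv f u = lam * f u)
    (g : ℝ → ℝ)
    (hg : ∀ x : ℝ, 0 < x → DifferentiableAt ℝ g x)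
    (hg' : ∀ x : ℝ, 0 < x → DifferentiableAt ℝ (deriv g) x)
    (hode : ∀ x : ℝ, 0 < x →
      x * deriv (deriv g) x + (1 - ε₁) * deriv g x + lam * ε₂ * g x = 0)
    (Y₁ Y₂ : ℝ → ℝ → ℝ)
    (hY₁ : ∀ u₁ u₂ : ℝ, Y₁ u₁ u₂ = f u₁ * g u₂)
    (hY₂ : ∀ u₁ u₂ : ℝ, Y₂ u₁ u₂ = -(u₂ / ε₂) * f u₁ * deriv g u₂) :
    ∀ u₁ u₂ : ℝ, 0 < u₂ →
      deriv (fun s => Y₁ u₁ s) u₂ = -(ε₂ / u₂) * Y₂ u₁ u₂ ∧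
      deriv (fun s => Y₂ u₁ s) u₂
        = (ε₁ / u₂) * Y₂ u₁ u₂ + deriv (fun s => Y₁ s u₂) u₁ := by
  intro u₁ u₂ hu
  have hu0 : u₂ ≠ 0 := hu.ne'
  have hder : HasDerivAt (fun s => -(s / ε₂) * f u₁ * deriv g s)
      (-(1 / ε₂) * f u₁ * deriv g u₂ + -(u₂ / ε₂) * f u₁ * deriv (deriv g) u₂) u₂ :=
    ((((hasDerivAt_id u₂).div_const ε₂).neg).mul_const (f u₁)).mul (hg' u₂ hu).hasDerivAt
  simp only [hY₁, hY₂]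
  rw [deriv_const_mul _ (hg u₂ hu), hder.deriv, deriv_mul_const (hf u₁), hf']
  constructor
  · field_simp
  · field_simp
    linear_combination (-f u₁) * hode u₂ hu
end
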